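/- Let k be an algebraically closed field and let R be a k-algebra whose center Z(R) is an affine k-algebra. Assume that R is an Azumaya algebra over Z(R), and that there is an integer n ≥ 1 such that for every maximal ideal m of Z(R) the quotient ring R/mR has dimension n² as a k-vector space. Then the central character map is a bijection: every k-algebra homomorphism τ : Z(R) → k is the central character of exactly one equivalence class of finite-dimensional irreducible representations of R. -/

import Mathlib

/-- `R` is an algebra over its center (the center being taken as a `k`-subalgebra). -/
noncomputable instance centerAlgebra (k R : Type*) [CommSemiring k] [Ring R] [Algebra k R] :
    Algebra (Subalgebra.center k R) R :=
  inferInstanceAs (Algebra (Subring.center R) R)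

/-- Two matrix representations of a `k`-algebra are equivalent if they have the same
dimension and are conjugate by an invertible matrix. -/
def RepEquiv {k A : Type*} [CommSemiring k] [Semiring A] [Algebra k A] {n₁ n₂ : ℕ}
    (ρ₁ : A →ₐ[k] Matrix (Fin n₁) (Fin n₁) k) (ρ₂ : A →ₐ[k] Matrix (Fin n₂) (Fin n₂) k) :
    Prop :=
  ∃ h : n₁ = n₂, ∃ x : (Matrix (Fin n₂) (Fin n₂) k)ˣ,
    ∀ a : A, Matrix.reindex (finCongr h) (finCongr h) (ρ₁ a) = x.val * ρ₂ a * (x⁻¹).val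

/-- The natural map `A ⊗_C Aᵒᵖ → End_C A`, `α ⊗ β ↦ (γ ↦ α γ β)`.  An algebra `A` which is a
faithful finitely generated projective `C`-module is Azumaya over `C` iff this map is
bijective. -/
noncomputable def azumayaMulLeftRight (C A : Type*) [CommSemiring C] [Semiring A]
    [Algebra C A] : TensorProduct C A Aᵐᵒᵖ →ₗ[C] Module.End C A :=
  TensorProduct.lift <| LinearMap.mk₂ C
    (fun a b => LinearMap.mulLeft C a ∘ₗ LinearMap.mulRight C b.unop)
    (fun a a' b => by ext c; simp [add_mul])
    (fun s a b => by ext c; simp [smul_mul_assoc])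
    (fun a b b' => by ext c; simp [mul_add])
    (fun s a b => by ext c; simp [mul_smul_comm])

/-- If `A ⊗ Aᵐᵒᵖ → End_C A` is surjective, every two-sided ideal of `A` is stable under all
`C`-linear endomorphisms of `A`. -/
theorem Ideal.apply_mem_of_azumayaMulLeftRight_surjective {C A : Type*} [CommRing C] [Ring A]
    [Algebra C A] (h : Function.Surjective (azumayaMulLeftRight C A)) (J : Ideal A)
    [J.IsTwoSided] (φ : Module.End C A) {x : A} (hx : x ∈ J) : φ x ∈ J := by
  obtain ⟨t, rfl⟩ := h φ
  induction t with
  | zero => simp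
  | tmul a b =>
    have : azumayaMulLeftRight C A (TensorProduct.tmul C a b) x = a * (x * b.unop) := by
      simp [azumayaMulLeftRight]
    rw [this]
    exact J.mul_mem_left _ (J.mul_mem_right _ hx)
  | add s t hs ht =>
    rw [map_add, LinearMap.add_apply]
    exact J.add_mem hs ht

/-- Two-sided ideals of an Azumaya algebra are generated by their intersection with the base. -/
theorem Ideal.le_map_comap_of_azumayaMulLeftRight_surjective {C A : Type*} [CommRing C] [Ring A]
    [Algebra C A] [Module.Projective C A]
    (h : Function.Surjective (azumayaMulLeftRight C A)) (J : Ideal A) [J.IsTwoSided] :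
    J ≤ (J.comap (algebraMap C A)).map (algebraMap C A) := by
  intro x hx
  obtain ⟨s, hs⟩ := Module.projective_def'.1 (inferInstance : Module.Projective C A)
  have hx' : Finsupp.linearCombination C id (s x) = x := LinearMap.congr_fun hs x
  rw [← hx', Finsupp.linearCombination_apply]
  refine Ideal.sum_mem _ fun a _ => ?_
  have hmem : s x a ∈ J.comap (algebraMap C A) :=
    J.apply_mem_of_azumayaMulLeftRight_surjective h
      (Algebra.linearMap C A ∘ₗ Finsupp.lapply a ∘ₗ s) hx
  change s x a • a ∈ _
  rw [Algebra.smul_def, Algebra.commutes]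
  exact Ideal.mul_mem_left _ _ (Ideal.mem_map_of_mem _ hmem)

/-- A proper two-sided ideal of an Azumaya algebra lying over a maximal ideal `m` of the base is
generated by `m`. -/
theorem Ideal.eq_map_of_azumayaMulLeftRight_surjective {C A : Type*} [CommRing C] [Ring A]
    [Algebra C A] [Module.Projective C A]
    (h : Function.Surjective (azumayaMulLeftRight C A)) {m : Ideal C} (hm : m.IsMaximal)
    {J : Ideal A} [J.IsTwoSided] (hmJ : m.map (algebraMap C A) ≤ J) (hJ : J ≠ ⊤) :
    J = m.map (algebraMap C A) := by
  have hcomap : m = J.comap (algebraMap C A) :=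
    hm.eq_of_le (Ideal.comap_ne_top _ hJ) (Ideal.map_le_iff_le_comap.1 hmJ)
  refine le_antisymm ?_ hmJ
  rw [hcomap]
  exact J.le_map_comap_of_azumayaMulLeftRight_surjective h

/-- An ideal generated by elements of a central subring is two-sided. -/
theorem Ideal.isTwoSided_map_algebraMap {C A : Type*} [CommRing C] [Ring A] [Algebra C A]
    (m : Ideal C) : (m.map (algebraMap C A)).IsTwoSided := by
  refine ⟨fun {a} b ha => ?_⟩
  induction ha using Submodule.span_induction with
  | mem x hx =>
    obtain ⟨c, hc, rfl⟩ := hx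
    rw [Algebra.commutes]
    exact Ideal.mul_mem_left _ _ (Ideal.mem_map_of_mem _ hc)
  | zero => simp
  | add x y _ _ hx hy => rw [add_mul]; exact Ideal.add_mem _ hx hy
  | smul r x _ hx => rw [smul_eq_mul, mul_assoc]; exact Ideal.mul_mem_left _ _ hx

/-- The quotient by a proper two-sided ideal that is maximal among such is a simple ring. -/
theorem Ideal.isSimpleRing_quotient {A : Type*} [Ring A] (I : Ideal A) [I.IsTwoSided]
    (hI : I ≠ ⊤) (hmax : ∀ J : Ideal A, J.IsTwoSided → I ≤ J → J ≠ ⊤ → J = I) :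
    IsSimpleRing (A ⧸ I) := by
  have : Nontrivial (A ⧸ I) := Ideal.Quotient.nontrivial_iff.2 hI
  refine IsSimpleRing.of_eq_bot_or_eq_top fun K => ?_
  have hJ : ((TwoSidedIdeal.asIdeal K).comap (Ideal.Quotient.mk I)).IsTwoSided :=
    ⟨fun {a} b ha => by
      simp only [Ideal.mem_comap, TwoSidedIdeal.mem_asIdeal, map_mul] at ha ⊢
      exact K.mul_mem_right _ _ ha⟩
  by_cases htop : (TwoSidedIdeal.asIdeal K).comap (Ideal.Quotient.mk I) = ⊤
  · right
    rw [← TwoSidedIdeal.one_mem_iff]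
    have hone := (Ideal.eq_top_iff_one _).1 htop
    rwa [Ideal.mem_comap, map_one, TwoSidedIdeal.mem_asIdeal] at hone
  · left
    have hle : I ≤ (TwoSidedIdeal.asIdeal K).comap (Ideal.Quotient.mk I) := fun x hx => by
      simp [Ideal.mem_comap, Ideal.Quotient.eq_zero_iff_mem.2 hx]
    have heq := hmax _ hJ hle htop
    refine le_antisymm (fun y hy => ?_) bot_le
    obtain ⟨x, rfl⟩ := Ideal.Quotient.mk_surjective y
    have hx : x ∈ (TwoSidedIdeal.asIdeal K).comap (Ideal.Quotient.mk I) := by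
      simpa [Ideal.mem_comap] using hy
    rw [heq] at hx
    rw [Ideal.Quotient.eq_zero_iff_mem.2 hx]
    exact TwoSidedIdeal.zero_mem _

/-- **Skolem–Noether** for matrix algebras: every automorphism is inner. -/
theorem Matrix.exists_units_conj_of_algEquiv {k ι : Type*} [Field k] [Fintype ι] [DecidableEq ι]
    (e : Matrix ι ι k ≃ₐ[k] Matrix ι ι k) :
    ∃ x : (Matrix ι ι k)ˣ, ∀ M, e M = x.val * M * (x⁻¹).val := by
  let L : Matrix ι ι k ≃ₐ[k] Module.End k (ι → k) := Matrix.toLinAlgEquiv'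
  obtain ⟨T, hT⟩ := ((L.symm.trans e).trans L).eq_linearEquivConjAlgEquiv
  refine ⟨⟨L.symm T, L.symm T.symm, ?_, ?_⟩, fun M => ?_⟩
  · rw [← map_mul, ← map_one L.symm]; exact congrArg L.symm (LinearMap.ext fun v => T.apply_symm_apply v)
  · rw [← map_mul, ← map_one L.symm]; exact congrArg L.symm (LinearMap.ext fun v => T.symm_apply_apply v)
  · have h := AlgEquiv.congr_fun hT (L M)
    apply L.injective
    simp only [AlgEquiv.trans_apply, AlgEquiv.symm_apply_apply] at h
    simp only [Units.inv_mk, map_mul, AlgEquiv.apply_symm_apply]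
    rw [h, LinearEquiv.conjAlgEquiv_apply]
    rfl

/-- Surjective matrix representations with the same kernel are equivalent. -/
theorem repEquiv_of_ker_eq {k A : Type*} [Field k] [Ring A] [Algebra k A] {n₁ n₂ : ℕ}
    {ρ₁ : A →ₐ[k] Matrix (Fin n₁) (Fin n₁) k} {ρ₂ : A →ₐ[k] Matrix (Fin n₂) (Fin n₂) k}
    (h₁ : Function.Surjective ρ₁) (h₂ : Function.Surjective ρ₂)
    (hker : RingHom.ker ρ₁ = RingHom.ker ρ₂) : RepEquiv ρ₁ ρ₂ := by
  let e : Matrix (Fin n₂) (Fin n₂) k ≃ₐ[k] Matrix (Fin n₁) (Fin n₁) k :=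
    ((Ideal.quotientKerAlgEquivOfSurjective h₂).symm.trans
      (Ideal.quotientEquivAlgOfEq k hker.symm)).trans (Ideal.quotientKerAlgEquivOfSurjective h₁)
  have he : ∀ a, e (ρ₂ a) = ρ₁ a := fun a => by
    have : (Ideal.quotientKerAlgEquivOfSurjective h₂).symm (ρ₂ a) =
        Ideal.Quotient.mk (RingHom.ker ρ₂) a := by
      rw [AlgEquiv.symm_apply_eq]; rfl
    simp only [e, AlgEquiv.trans_apply, this]
    rfl
  have hn : n₁ = n₂ := by
    have := e.toLinearEquiv.finrank_eq
    simp only [Module.finrank_matrix, Fintype.card_fin, Module.finrank_self, mul_one] at this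
    exact (Nat.mul_self_inj.1 this).symm
  subst hn
  obtain ⟨x, hx⟩ := Matrix.exists_units_conj_of_algEquiv e
  refine ⟨rfl, x, fun a => ?_⟩
  rw [← hx, he]
  rfl

/-- **The central character map of an Azumaya algebra of constant rank `n²` is bijective.**
Let `k` be an algebraically closed field and `R` a `k`-algebra whose center `Z(R)` is an
affine `k`-algebra.  Assume `R` is Azumaya over `Z(R)` and that for some `n ≥ 1` every
quotient `R/mR`, for `m` a maximal ideal of `Z(R)`, has `k`-dimension `n²`.  Then every
`k`-algebra homomorphism `τ : Z(R) → k` is the central character of exactly one equivalence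
class of finite-dimensional irreducible representations of `R`. -/
theorem azumaya_central_character_bijective
    (k R : Type*) [Field k] [IsAlgClosed k] [Ring R] [Algebra k R]
    (haffine : Algebra.FiniteType k (Subalgebra.center k R))
    (hfaithful : FaithfulSMul (Subalgebra.center k R) R)
    (hfg : Module.Finite (Subalgebra.center k R) R)
    (hproj : Module.Projective (Subalgebra.center k R) R)
    (hbij : Function.Bijective (azumayaMulLeftRight (Subalgebra.center k R) R))
    (n : ℕ) (hn : 1 ≤ n)
    (hrank : ∀ m : Ideal (Subalgebra.center k R), m.IsMaximal →
      Module.finrank k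
        (R ⧸ Ideal.map (algebraMap (Subalgebra.center k R) R) m) = n ^ 2)
    (τ : Subalgebra.center k R →ₐ[k] k) :
    (∃ (d : ℕ) (ρ : R →ₐ[k] Matrix (Fin d) (Fin d) k),
      1 ≤ d ∧ Function.Surjective ρ ∧
        ∀ z : Subalgebra.center k R,
          ρ (z : R) = τ z • (1 : Matrix (Fin d) (Fin d) k)) ∧
    (∀ (d₁ d₂ : ℕ), 1 ≤ d₁ → 1 ≤ d₂ →
      ∀ (ρ₁ : R →ₐ[k] Matrix (Fin d₁) (Fin d₁) k)
        (ρ₂ : R →ₐ[k] Matrix (Fin d₂) (Fin d₂) k),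
      Function.Surjective ρ₁ → Function.Surjective ρ₂ →
      (∀ z : Subalgebra.center k R,
        ρ₁ (z : R) = τ z • (1 : Matrix (Fin d₁) (Fin d₁) k)) →
      (∀ z : Subalgebra.center k R,
        ρ₂ (z : R) = τ z • (1 : Matrix (Fin d₂) (Fin d₂) k)) →
      RepEquiv ρ₁ ρ₂) := by
  have hm : (RingHom.ker τ).IsMaximal :=
    RingHom.ker_isMaximal_of_surjective τ fun c => ⟨algebraMap k _ c, τ.commutes c⟩
  set I := (RingHom.ker τ).map (algebraMap (Subalgebra.center k R) R)
  have hI : I.IsTwoSided := Ideal.isTwoSided_map_algebraMap _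
  have hpos : 0 < Module.finrank k (R ⧸ I) := by rw [hrank _ hm]; positivity
  refine ⟨?_, fun d₁ d₂ hd₁ hd₂ ρ₁ ρ₂ h₁ h₂ hτ₁ hτ₂ => ?_⟩
  · have hIne : I ≠ ⊤ := by
      intro h
      have := Ideal.Quotient.subsingleton_iff.2 h
      exact hpos.ne' Module.finrank_zero_of_subsingleton
    have : IsSimpleRing (R ⧸ I) := I.isSimpleRing_quotient hIne fun J _ hle hne =>
      Ideal.eq_map_of_azumayaMulLeftRight_surjective hbij.2 hm hle hne
    have : FiniteDimensional k (R ⧸ I) := Module.finite_of_finrank_pos hpos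
    obtain ⟨d, hd, ⟨e⟩⟩ := IsSimpleRing.exists_algEquiv_matrix_of_isAlgClosed k (R ⧸ I)
    refine ⟨d, e.toAlgHom.comp (Ideal.Quotient.mkₐ k I), NeZero.one_le,
      e.surjective.comp (Ideal.Quotient.mkₐ_surjective k I), fun z => ?_⟩
    have hz : z - algebraMap k _ (τ z) ∈ RingHom.ker τ := by
      simp [RingHom.mem_ker]
    have hz' : (z : R) - algebraMap k R (τ z) ∈ I := Ideal.mem_map_of_mem (algebraMap _ R) hz
    have hq : Ideal.Quotient.mkₐ k I z = algebraMap k _ (τ z) := by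
      rw [← (Ideal.Quotient.mkₐ k I).commutes]
      exact Ideal.Quotient.eq.2 hz'
    change e (Ideal.Quotient.mkₐ k I z) = _
    rw [hq, e.commutes, Algebra.algebraMap_eq_smul_one]
  · have key : ∀ (d : ℕ), 1 ≤ d → ∀ ρ : R →ₐ[k] Matrix (Fin d) (Fin d) k,
        (∀ z : Subalgebra.center k R, ρ (z : R) = τ z • (1 : Matrix (Fin d) (Fin d) k)) →
        RingHom.ker ρ = I := by
      intro d hd ρ hρ
      have : NeZero d := ⟨by omega⟩
      refine Ideal.eq_map_of_azumayaMulLeftRight_surjective hbij.2 hm ?_ (RingHom.ker_ne_top ρ)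
      refine Ideal.map_le_iff_le_comap.2 fun z hz => ?_
      change ρ (z : R) = 0
      rw [hρ, (RingHom.mem_ker).1 hz, zero_smul]
    exact repEquiv_of_ker_eq h₁ h₂ ((key d₁ hd₁ ρ₁ hτ₁).trans (key d₂ hd₂ ρ₂ hτ₂).symm)
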